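/- Let p > 5 and set α = 2/(p−1) − 1, so α ∈ (−1, −1/2). There exists C > 0 depending only on p such that for any u ∈ H^{s_p}(ℝ^3) radial, with s_p = 3/2 − 2/(p−1), one has ∫_0^1 (1−r^2)^α |u(r)|^{p+1} r^2 dr ≤ C ‖u‖_{H^{s_p}}^{p+1}. -/

import Mathlib

open Set MeasureTheory Real FourierTransform

/-- The `H^s(ℝ³)` norm, defined via the Fourier transform. -/
noncomputable def HsNorm (s : ℝ) (u : EuclideanSpace ℝ (Fin 3) → ℂ) : ℝ :=
  (∫ ξ : EuclideanSpace ℝ (Fin 3), (1 + ‖ξ‖ ^ 2) ^ s * ‖𝓕 u ξ‖ ^ 2) ^ (1 / 2 : ℝ)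


lemma gauss_inv {V : Type*} [NormedAddCommGroup V] [InnerProductSpace ℝ V]
    [MeasurableSpace V] [BorelSpace V] [FiniteDimensional ℝ V] {f : V → ℂ}
    (hf : Integrable f) (v : V) (h'f : ContinuousAt f v) :
    Filter.Tendsto (fun (c : ℝ) ↦ (∫ w : V, Complex.exp (- (c:ℂ)⁻¹ * ‖w‖ ^ 2 + 2 * π * Complex.I * (inner ℝ v w : ℝ))
       • (𝓕 f) w)) Filter.atTop (nhds (f v)) := by
  have B := Real.tendsto_integral_gaussian_smul' hf h'f
  have B2 : Filter.Tendsto (fun (c : ℝ) ↦ (∫ w : V,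
        𝓕 (fun w : V ↦ Complex.exp (- (c:ℂ)⁻¹ * ‖w‖ ^ 2 + 2 * π * Complex.I * (inner ℝ v w : ℝ))) w • f w)) Filter.atTop
      (nhds (f v)) := by
    apply B.congr'
    filter_upwards [Filter.Ioi_mem_atTop 0] with c (hc : 0 < c)
    congr with w
    rw [fourier_gaussian_innerProductSpace' (by simpa)]
    rw [div_inv_eq_mul]
    congr 3
    rw [div_inv_eq_mul]
    ring
  apply B2.congr'
  filter_upwards [Filter.Ioi_mem_atTop 0] with c (hc : 0 < c)
  have J : Integrable (fun w : V ↦ Complex.exp (- (c:ℂ)⁻¹ * ‖w‖ ^ 2 + 2 * π * Complex.I * (inner ℝ v w : ℝ))) :=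
    GaussianFourier.integrable_cexp_neg_mul_sq_norm_add (by simpa) _ _
  simpa using! (VectorFourier.integral_fourierIntegral_smul_eq_flip (L := innerₗ V)
      Real.continuous_fourierChar continuous_inner J hf)

lemma subst_lem (z : ℝ) (G : ℝ → ℂ) :
    ∫ σ in Ioi (0:ℝ), (σ:ℝ) • G (√(z ^ 2 + σ ^ 2)) = ∫ ρ in Ioi |z|, ρ • G ρ := by
  have himg : (fun σ => √(z ^ 2 + σ ^ 2)) '' Ioi 0 = Ioi |z| := by
    ext ρ
    simp only [mem_image, mem_Ioi]
    constructor
    · rintro ⟨σ, hσ, rfl⟩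
      rw [← Real.sqrt_sq_eq_abs]
      apply Real.sqrt_lt_sqrt (by positivity)
      have := pow_pos hσ 2
      linarith
    · intro h
      have h0 : 0 < ρ := lt_of_le_of_lt (abs_nonneg z) h
      have h1 : z ^ 2 < ρ ^ 2 := sq_lt_sq.2 (by rwa [abs_of_pos h0])
      refine ⟨√(ρ ^ 2 - z ^ 2), Real.sqrt_pos.2 (by linarith), ?_⟩
      rw [Real.sq_sqrt (by linarith), add_sub_cancel, Real.sqrt_sq h0.le]
  have hpos : ∀ σ ∈ Ioi (0:ℝ), 0 < z ^ 2 + σ ^ 2 := fun σ hσ => by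
    have := pow_pos (mem_Ioi.1 hσ) 2
    positivity
  rw [← himg, integral_image_eq_integral_abs_deriv_smul (f' := fun σ => σ / √(z ^ 2 + σ ^ 2)) measurableSet_Ioi]
  · refine setIntegral_congr_fun measurableSet_Ioi fun σ hσ => ?_
    have h1 := Real.sqrt_pos.2 (hpos σ hσ)
    have h2 : (0:ℝ) < σ := hσ
    simp only [smul_smul]
    rw [abs_of_pos (by positivity)]
    congr 1
    field_simp
  · intro σ hσ
    have h1 := hpos σ hσ
    have : HasDerivAt (fun σ : ℝ => z ^ 2 + σ ^ 2) (2 * σ) σ := by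
      simpa using (hasDerivAt_pow 2 σ).const_add (z ^ 2)
    have := this.sqrt h1.ne'
    rw [mul_div_mul_left _ _ two_ne_zero] at this
    exact this.hasDerivWithinAt
  · intro a ha b hb hab
    simp only at hab
    rw [Real.sqrt_inj (hpos a ha).le (hpos b hb).le] at hab
    have ha' : (0:ℝ) < a := ha
    have hb' : (0:ℝ) < b := hb
    nlinarith

lemma polar_lem (z : ℝ) (G : ℝ → ℂ) :
    ∫ q : ℝ × ℝ, G (√(z ^ 2 + (q.1 ^ 2 + q.2 ^ 2))) = (2 * π : ℝ) • ∫ ρ in Ioi |z|, ρ • G ρ := by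
  rw [← integral_comp_polarCoord_symm, ← subst_lem]
  have : ∀ p : ℝ × ℝ, p.1 • G (√(z ^ 2 + ((polarCoord.symm p).1 ^ 2 + (polarCoord.symm p).2 ^ 2))) = (p.1 • G (√(z ^ 2 + p.1 ^ 2))) * (1:ℂ) := by
    intro p
    rw [polarCoord_symm_apply]
    simp only
    rw [mul_one]
    congr 4
    linear_combination p.1^2 * Real.sin_sq_add_cos_sq p.2
  simp_rw [this]
  rw [polarCoord_target, Measure.volume_eq_prod, setIntegral_prod_mul (fun x : ℝ => x • G (√(z ^ 2 + x ^ 2))) (fun _ => (1:ℂ))]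
  simp only [integral_const, MeasurableSet.univ, measureReal_restrict_apply, univ_inter, volume_real_Ioo_of_le (show -π ≤ π by linarith [pi_pos])]
  rw [mul_comm]
  simp
  left; ring

lemma cart_lem (f : ℝ × (ℝ × ℝ) → ℂ) :
    ∫ x : EuclideanSpace ℝ (Fin 3), f (x 0, (x 1, x 2)) = ∫ q, f q := by
  have h1 := (PiLp.volume_preserving_ofLp (Fin 3))
  have h2 := volume_preserving_piFinSuccAbove (fun _ : Fin 3 => ℝ) 0
  have h3 := (MeasurePreserving.id (volume : Measure ℝ)).prod (volume_preserving_finTwoArrow ℝ)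
  have h4 := (h3.comp h2).comp h1
  have he : MeasurableEmbedding ((Prod.map id (MeasurableEquiv.finTwoArrow (α := ℝ)) ∘ (MeasurableEquiv.piFinSuccAbove (fun _ : Fin 3 => ℝ) 0)) ∘ (WithLp.ofLp (p := 2) : EuclideanSpace ℝ (Fin 3) → _)) := by
    refine (MeasurableEmbedding.comp ?_ (MeasurableEquiv.measurableEmbedding _)).comp ?_
    · exact (MeasurableEquiv.prodCongr (MeasurableEquiv.refl ℝ) (MeasurableEquiv.finTwoArrow (α := ℝ))).measurableEmbedding
    · exact (MeasurableEquiv.toLp 2 (Fin 3 → ℝ)).symm.measurableEmbedding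
  have h5 := h4.integral_comp he f
  exact h5

lemma radial_formula (G : ℝ → ℂ) (hG : Continuous G) (M b : ℝ) (hb : 0 < b)
    (hM : ∀ ρ, ‖G ρ‖ ≤ M * Real.exp (-b * ρ ^ 2)) (r : ℝ) :
    ∫ x : EuclideanSpace ℝ (Fin 3), Complex.exp ((2 * π * r : ℝ) * Complex.I * (x 0 : ℝ)) * G ‖x‖
      = (2 * π : ℝ) • ∫ ρ in Ioi (0:ℝ), ρ • (G ρ * ∫ z in (-ρ)..ρ, Complex.exp ((2 * π * r : ℝ) * Complex.I * (z : ℝ))) := by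
  set e : ℝ → ℂ := fun z => Complex.exp ((2 * π * r : ℝ) * Complex.I * (z : ℝ)) with he
  have hec : Continuous e := by rw [he]; fun_prop
  have hen : ∀ z, ‖e z‖ = 1 := fun z => by
    rw [he]
    have : ((2 * π * r : ℝ) : ℂ) * Complex.I * (z : ℝ) = ((2 * π * r * z : ℝ) : ℂ) * Complex.I := by
      push_cast; ring
    simp only [this, Complex.norm_exp_ofReal_mul_I]
  have hM0 : 0 ≤ M := by
    have := (norm_nonneg _).trans (hM 0)
    simpa using this
  let f : ℝ × (ℝ × ℝ) → ℂ := fun q => e q.1 * G (√(q.1 ^ 2 + (q.2.1 ^ 2 + q.2.2 ^ 2)))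
  have hnorm : ∀ x : EuclideanSpace ℝ (Fin 3), e (x 0) * G ‖x‖ = f (x 0, (x 1, x 2)) := by
    intro x
    simp only [f]
    rw [EuclideanSpace.norm_eq, Fin.sum_univ_three]
    simp only [Real.norm_eq_abs, sq_abs, add_assoc]
  have hfi : Integrable f (volume.prod (volume.prod volume)) := by
    have hg := integrable_exp_neg_mul_sq hb
    have := (hg.mul_prod (hg.mul_prod hg)).const_mul M
    refine this.mono' ?_ (Filter.Eventually.of_forall fun q => ?_)
    · apply Continuous.aestronglyMeasurable
      fun_prop
    · simp only [f, norm_mul, hen, one_mul]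
      refine (hM _).trans (le_of_eq ?_)
      rw [Real.sq_sqrt (by positivity), ← Real.exp_add, ← Real.exp_add]
      congr 2
      ring
  calc ∫ x : EuclideanSpace ℝ (Fin 3), e (x 0) * G ‖x‖
      = ∫ q, f q := by
        rw [← cart_lem]; simp_rw [hnorm]
    _ = ∫ z, ∫ q : ℝ × ℝ, f (z, q) := by
        rw [Measure.volume_eq_prod]; exact integral_prod _ hfi
    _ = ∫ z, (2 * π : ℝ) • ∫ ρ in Ioi (0:ℝ), (if |z| < ρ then e z * (ρ • G ρ) else 0) := by
        congr 1; ext z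
        simp only [f]
        rw [integral_const_mul, polar_lem, mul_smul_comm, ← integral_const_mul]
        congr 1
        have : (fun ρ : ℝ => if |z| < ρ then e z * (ρ • G ρ) else 0) = (Ioi |z|).indicator (fun ρ => e z * (ρ • G ρ)) := by
          ext ρ; simp [indicator_apply]
        rw [this, setIntegral_indicator measurableSet_Ioi, Ioi_inter_Ioi, sup_eq_right.2 (abs_nonneg z)]
    _ = (2 * π : ℝ) • ∫ z, ∫ ρ in Ioi (0:ℝ), (if |z| < ρ then e z * (ρ • G ρ) else 0) := by
        rw [integral_smul]
    _ = (2 * π : ℝ) • ∫ ρ in Ioi (0:ℝ), ∫ z, (if |z| < ρ then e z * (ρ • G ρ) else 0) := by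
        congr 1
        apply integral_integral_swap
        have hb2 : 0 < b / 2 := by positivity
        have h1 := (integrable_exp_neg_mul_sq hb2).mul_prod ((integrable_mul_exp_neg_mul_sq hb2).norm.integrableOn (s := Ioi 0))
        refine (h1.const_mul M).mono' ?_ (Filter.Eventually.of_forall fun q => ?_)
        · apply Measurable.aestronglyMeasurable
          apply Measurable.ite
          · exact measurableSet_lt (by fun_prop) (by fun_prop)
          · apply Continuous.measurable
            fun_prop
          · exact measurable_const
        · obtain ⟨z, ρ⟩ := q
          simp only [Function.uncurry]
          split_ifs with h
          · have h0 : 0 < ρ := (abs_nonneg z).trans_lt h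
            have hz : z ^ 2 ≤ ρ ^ 2 := sq_le_sq.2 (by rw [abs_of_pos h0]; exact h.le)
            rw [norm_mul, hen, one_mul, norm_smul, norm_mul, Real.norm_of_nonneg (Real.exp_nonneg _)]
            calc ‖ρ‖ * ‖G ρ‖ ≤ ‖ρ‖ * (M * (Real.exp (-(b/2) * z ^ 2) * Real.exp (-(b/2) * ρ ^ 2))) := by
                  gcongr
                  refine (hM ρ).trans ?_
                  gcongr
                  rw [← Real.exp_add]
                  apply Real.exp_le_exp.2
                  nlinarith
              _ = _ := by ring
          · rw [norm_zero]; positivity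
    _ = _ := by
        congr 1
        refine setIntegral_congr_fun measurableSet_Ioi fun ρ hρ => ?_
        have h0 : (0:ℝ) < ρ := hρ
        have : (fun z : ℝ => if |z| < ρ then e z * (ρ • G ρ) else 0) = (Ioo (-ρ) ρ).indicator (fun z => e z * (ρ • G ρ)) := by
          ext z; simp [indicator_apply, abs_lt]
        rw [this, integral_indicator measurableSet_Ioo, integral_mul_const, intervalIntegral.integral_of_le (by linarith), integral_Ioc_eq_integral_Ioo, mul_comm, smul_mul_assoc]

lemma kernel_bound (r ρ a : ℝ) (hr : 0 < r) (hρ : 0 < ρ) (ha0 : 0 ≤ a) (ha1 : a ≤ 1) :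
    ‖∫ z in (-ρ)..ρ, Complex.exp ((2 * π * r : ℝ) * Complex.I * (z : ℝ))‖ ≤ 2 * (ρ ^ (1 - a) * r ^ (-a)) := by
  have hen : ∀ z : ℝ, ‖Complex.exp ((2 * π * r : ℝ) * Complex.I * (z : ℝ))‖ = 1 := fun z => by
    have : ((2 * π * r : ℝ) : ℂ) * Complex.I * (z : ℝ) = ((2 * π * r * z : ℝ) : ℂ) * Complex.I := by
      push_cast; ring
    simp only [this, Complex.norm_exp_ofReal_mul_I]
  set X := ‖∫ z in (-ρ)..ρ, Complex.exp ((2 * π * r : ℝ) * Complex.I * (z : ℝ))‖ with hX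
  have hX0 : 0 ≤ X := norm_nonneg _
  have h1 : X ≤ 2 * ρ := by
    have := intervalIntegral.norm_integral_le_of_norm_le_const (a := -ρ) (b := ρ) (C := 1) (f := fun z : ℝ => Complex.exp ((2 * π * r : ℝ) * Complex.I * (z : ℝ))) (fun z _ => (hen z).le)
    rw [abs_of_pos (by linarith)] at this
    linarith
  have hp : 0 < 2 * π * r := by positivity
  have h2 : X ≤ 2 / r := by
    rw [hX, integral_exp_mul_complex (mul_ne_zero (Complex.ofReal_ne_zero.2 hp.ne') Complex.I_ne_zero), norm_div]
    have : ‖((2 * π * r : ℝ) : ℂ) * Complex.I‖ = 2 * π * r := by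
      rw [norm_mul, Complex.norm_I, mul_one, Complex.norm_real, Real.norm_of_nonneg hp.le]
    rw [this]
    gcongr
    · refine (norm_sub_le _ _).trans ?_
      rw [hen, hen]; norm_num
    · nlinarith [Real.pi_gt_three]
  calc X = X ^ (1 - a) * X ^ a := by
        rw [← Real.rpow_add_of_nonneg hX0 (by linarith) ha0]; simp
    _ ≤ (2 * ρ) ^ (1 - a) * (2 / r) ^ a := by
        gcongr
    _ = 2 * (ρ ^ (1 - a) * r ^ (-a)) := by
        rw [Real.mul_rpow (by norm_num) hρ.le, Real.div_rpow (by norm_num) hr.le, Real.rpow_neg hr.le]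
        have : (2:ℝ) ^ (1 - a) * 2 ^ a = 2 := by
          rw [← Real.rpow_add (by norm_num)]; simp
        rw [div_eq_mul_inv]
        linear_combination (ρ ^ (1 - a) * (r ^ a)⁻¹) * this

lemma fourier_radial (u : EuclideanSpace ℝ (Fin 3) → ℂ) (U : ℝ → ℂ) (hu : ∀ x, u x = U ‖x‖)
    (v w : EuclideanSpace ℝ (Fin 3)) (h : ‖v‖ = ‖w‖) : 𝓕 u v = 𝓕 u w := by
  let A := Submodule.reflection (Submodule.span ℝ {v - w})ᗮ
  have hA : A v = w := Submodule.reflection_sub h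
  have h2 : u ∘ A = u := by
    ext x; simp only [Function.comp, hu, LinearIsometryEquiv.norm_map]
  have h3 := Real.fourier_comp_linearIsometry A u v
  rw [h2, hA] at h3
  exact h3

lemma pointwise_bound (s a : ℝ) (ha0 : 0 ≤ a) (ha1 : a ≤ 1) (hs : 3 / 2 - s < a) :
    ∃ C : ℝ, 0 < C ∧
      ∀ (u : EuclideanSpace ℝ (Fin 3) → ℂ) (U : ℝ → ℂ),
        Continuous u → Integrable u →
        (∀ x, u x = U ‖x‖) →
        Integrable (fun ξ : EuclideanSpace ℝ (Fin 3) =>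
          (1 + ‖ξ‖ ^ 2) ^ s * ‖𝓕 u ξ‖ ^ 2) →
        ∀ r : ℝ, 0 < r → ‖U r‖ ≤ C * HsNorm s u * r ^ (-a) := by
  set κ : ℝ := 3 * (volume : Measure (EuclideanSpace ℝ (Fin 3))).real (Metric.ball 0 1) with hκ
  have hκ0 : 0 < κ := by
    have : 0 < (volume : Measure (EuclideanSpace ℝ (Fin 3))).real (Metric.ball 0 1) := by
      rw [measureReal_def]
      exact ENNReal.toReal_pos (Metric.measure_ball_pos _ _ one_pos).ne' measure_ball_lt_top.ne
    positivity
  -- weight function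
  let g : ℝ → ℝ := fun ρ => ρ ^ (1 - a) * (1 + ρ ^ 2) ^ (-s / 2)
  have hgm : AEStronglyMeasurable g (volume.restrict (Ioi 0)) := by
    apply Measurable.aestronglyMeasurable
    fun_prop
  have hg0 : ∀ ρ ∈ Ioi (0:ℝ), 0 ≤ g ρ := fun ρ hρ => by
    have : (0:ℝ) < ρ := hρ
    positivity
  have hg2 : ∀ ρ ∈ Ioi (0:ℝ), g ρ ^ 2 ≤ (1 + ‖ρ‖ ^ 2) ^ (-(2 * (s - (1 - a))) / 2) := fun ρ hρ => by
    have h0 : (0:ℝ) < ρ := hρ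
    have h1 : (0:ℝ) < 1 + ρ ^ 2 := by positivity
    have e1 : g ρ ^ 2 = (ρ ^ 2) ^ (1 - a) * (1 + ρ ^ 2) ^ (-s) := by
      simp only [g]
      rw [mul_pow, ← Real.rpow_natCast, ← Real.rpow_mul h0.le, ← Real.rpow_natCast, ← Real.rpow_mul h1.le,
        ← Real.rpow_natCast, ← Real.rpow_mul h0.le]
      congr 2 <;> push_cast <;> ring
    rw [e1, Real.norm_eq_abs, sq_abs]
    calc (ρ ^ 2) ^ (1 - a) * (1 + ρ ^ 2) ^ (-s) ≤ (1 + ρ ^ 2) ^ (1 - a) * (1 + ρ ^ 2) ^ (-s) := by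
          gcongr
          linarith
      _ = _ := by
          rw [← Real.rpow_add h1]; congr 1; ring
  have hgL : MemLp g 2 (volume.restrict (Ioi 0)) := by
    rw [memLp_two_iff_integrable_sq hgm]
    have := (integrable_rpow_neg_one_add_norm_sq (E := ℝ) (μ := volume) (r := 2 * (s - (1 - a))) (by
      simp; linarith)).integrableOn (s := Ioi 0)
    refine this.mono' (hgm.pow 2) ?_
    refine (ae_restrict_iff' measurableSet_Ioi).2 (Filter.Eventually.of_forall fun ρ hρ => ?_)
    rw [Real.norm_of_nonneg (sq_nonneg _)]
    exact hg2 ρ hρ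
  set D : ℝ := (∫ ρ in Ioi (0:ℝ), g ρ ^ (2:ℝ)) ^ (1 / 2 : ℝ) with hD
  have hD0 : 0 ≤ D := by
    apply Real.rpow_nonneg
    apply setIntegral_nonneg measurableSet_Ioi
    intro ρ hρ
    exact Real.rpow_nonneg (hg0 ρ hρ) _
  refine ⟨4 * π * ((κ⁻¹) ^ (1 / 2 : ℝ) * D) + 1, by positivity, ?_⟩
  intro u U huc hui hrad hHs r hr
  set e0 : EuclideanSpace ℝ (Fin 3) := EuclideanSpace.single 0 1 with he0
  have hne0 : ‖e0‖ = 1 := by simp [he0]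
  set F : ℝ → ℂ := fun ρ => 𝓕 u (ρ • e0) with hF
  have hFc0 : Continuous (𝓕 u) :=
    VectorFourier.fourierIntegral_continuous Real.continuous_fourierChar
      (innerSL ℝ).continuous₂ hui
  have hFc : Continuous F := by rw [hF]; fun_prop
  have hFb : ∀ ρ, ‖F ρ‖ ≤ ∫ x, ‖u x‖ := fun ρ =>
    VectorFourier.norm_fourierIntegral_le_integral_norm _ _ _ _ _
  have hFr : ∀ ξ, 𝓕 u ξ = F ‖ξ‖ := fun ξ => fourier_radial u U hrad _ _ (by
    rw [norm_smul, hne0]; simp)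
  -- the H^s norm in polar coordinates
  let f : ℝ → ℝ := fun ρ => ρ * ‖F ρ‖ * (1 + ρ ^ 2) ^ (s / 2)
  have hfm : AEStronglyMeasurable f (volume.restrict (Ioi 0)) := by
    apply Measurable.aestronglyMeasurable
    fun_prop
  have hf2 : ∀ ρ, f ρ ^ 2 = ρ ^ (3 - 1) • ((1 + ρ ^ 2) ^ s * ‖F ρ‖ ^ 2) := fun ρ => by
    have h1 : (0:ℝ) < 1 + ρ ^ 2 := by positivity
    simp only [f, smul_eq_mul]
    rw [mul_pow, mul_pow, ← Real.rpow_natCast ((1 + ρ ^ 2) ^ (s / 2)), ← Real.rpow_mul h1.le]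
    push_cast
    rw [div_mul_cancel₀ _ two_ne_zero]
    ring
  have hfin : Module.finrank ℝ (EuclideanSpace ℝ (Fin 3)) = 3 := by simp
  have hfL : MemLp f 2 (volume.restrict (Ioi 0)) := by
    rw [memLp_two_iff_integrable_sq hfm]
    simp_rw [hFr] at hHs
    have := (integrable_fun_norm_addHaar (volume : Measure (EuclideanSpace ℝ (Fin 3))) (f := fun ρ => (1 + ρ ^ 2) ^ s * ‖F ρ‖ ^ 2)).1 hHs
    rw [hfin] at this
    simp_rw [hf2]
    exact this
  have hN : HsNorm s u = (κ * ∫ ρ in Ioi (0:ℝ), f ρ ^ (2:ℝ)) ^ (1 / 2 : ℝ) := by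
    rw [HsNorm]
    simp_rw [hFr]
    have := integral_fun_norm_addHaar (volume : Measure (EuclideanSpace ℝ (Fin 3))) (fun ρ => (1 + ρ ^ 2) ^ s * ‖F ρ‖ ^ 2)
    rw [hfin] at this
    rw [this]
    simp_rw [Real.rpow_two, hf2]
    congr 1
    rw [hκ]
    simp only [nsmul_eq_mul, smul_eq_mul]
    push_cast
    ring
  have hI0 : 0 ≤ ∫ ρ in Ioi (0:ℝ), f ρ ^ (2:ℝ) := by
    simp_rw [Real.rpow_two]
    exact integral_nonneg fun ρ => sq_nonneg _
  have hN0 : 0 ≤ HsNorm s u := by rw [hN]; positivity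
  have hCS : ∫ ρ in Ioi (0:ℝ), f ρ * g ρ ≤ (κ⁻¹) ^ (1 / 2 : ℝ) * D * HsNorm s u := by
    have h22 : (ENNReal.ofReal 2) = 2 := by simp
    have := integral_mul_le_Lp_mul_Lq_of_nonneg (μ := volume.restrict (Ioi (0:ℝ))) (f := f) (g := g) Real.HolderConjugate.two_two
      ((ae_restrict_iff' measurableSet_Ioi).2 (Filter.Eventually.of_forall fun ρ hρ => by
        have : (0:ℝ) < ρ := hρ
        simp only [f, Pi.zero_apply]; positivity))
      ((ae_restrict_iff' measurableSet_Ioi).2 (Filter.Eventually.of_forall fun ρ hρ => hg0 ρ hρ))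
      (by rw [h22]; exact hfL) (by rw [h22]; exact hgL)
    refine this.trans (le_of_eq ?_)
    rw [hN, Real.mul_rpow hκ0.le hI0, Real.inv_rpow hκ0.le]
    have : κ ^ (1 / 2 : ℝ) ≠ 0 := (Real.rpow_pos_of_pos hκ0 _).ne'
    rw [← hD]
    field_simp
  have hfgi : Integrable (fun ρ => f ρ * g ρ) (volume.restrict (Ioi 0)) := hfL.integrable_mul hgL
  have hUr : U r = u (r • e0) := by
    rw [hrad, norm_smul, hne0, mul_one, Real.norm_of_nonneg hr.le]
  rw [hUr]
  have hlim := (gauss_inv hui (r • e0) huc.continuousAt).norm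
  refine le_of_tendsto hlim ?_
  filter_upwards [Filter.Ioi_mem_atTop 0] with c (hc : 0 < c)
  set G : ℝ → ℂ := fun ρ => Complex.exp (((-c⁻¹ * ρ ^ 2 : ℝ) : ℂ)) * F ρ with hG
  have hGn : ∀ ρ, ‖G ρ‖ = Real.exp (-c⁻¹ * ρ ^ 2) * ‖F ρ‖ := fun ρ => by
    rw [hG]; simp only [norm_mul, Complex.norm_exp_ofReal]
  have hform := radial_formula G (by rw [hG]; fun_prop) (∫ x, ‖u x‖) c⁻¹ (by positivity) (fun ρ => by
    rw [hGn, mul_comm]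
    gcongr
    exact hFb ρ) r
  have heq : (∫ w : EuclideanSpace ℝ (Fin 3), Complex.exp (- (c:ℂ)⁻¹ * ‖w‖ ^ 2 + 2 * π * Complex.I * (inner ℝ (r • e0) w : ℝ))
       • (𝓕 u) w) = ∫ x : EuclideanSpace ℝ (Fin 3), Complex.exp ((2 * π * r : ℝ) * Complex.I * (x 0 : ℝ)) * G ‖x‖ := by
    congr 1; ext w
    rw [hFr, hG, smul_eq_mul]
    simp only
    rw [← mul_assoc, ← Complex.exp_add]
    congr 2
    rw [inner_smul_left, he0, EuclideanSpace.inner_single_left]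
    push_cast
    simp
    ring
  rw [heq, hform, norm_smul, Real.norm_of_nonneg (by positivity)]
  have hb1 : ‖∫ ρ in Ioi (0:ℝ), ρ • (G ρ * ∫ z in (-ρ)..ρ, Complex.exp ((2 * π * r : ℝ) * Complex.I * (z : ℝ)))‖
      ≤ ∫ ρ in Ioi (0:ℝ), (2 * r ^ (-a)) * (f ρ * g ρ) := by
    apply norm_integral_le_of_norm_le (hfgi.const_mul _)
    refine (ae_restrict_iff' measurableSet_Ioi).2 (Filter.Eventually.of_forall fun ρ hρ => ?_)
    have h0 : (0:ℝ) < ρ := hρ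
    have h1 : (0:ℝ) < 1 + ρ ^ 2 := by positivity
    rw [norm_smul, norm_mul, Real.norm_of_nonneg h0.le]
    have hk := kernel_bound r ρ a hr h0 ha0 ha1
    have hGF : ‖G ρ‖ ≤ ‖F ρ‖ := by
      rw [hGn]
      have : Real.exp (-c⁻¹ * ρ ^ 2) ≤ 1 := by
        rw [Real.exp_le_one_iff]
        have : 0 ≤ c⁻¹ * ρ ^ 2 := by positivity
        linarith
      nlinarith [norm_nonneg (F ρ)]
    calc _ ≤ ρ * (‖F ρ‖ * (2 * (ρ ^ (1 - a) * r ^ (-a)))) := by gcongr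
      _ = _ := by
        simp only [f, g]
        have : (1 + ρ ^ 2) ^ (s / 2) * (1 + ρ ^ 2) ^ (-s / 2) = 1 := by
          rw [← Real.rpow_add h1, neg_div, add_neg_cancel, Real.rpow_zero]
        linear_combination (-2 * r ^ (-a) * ρ * ‖F ρ‖ * ρ ^ (1 - a)) * this
  rw [integral_const_mul] at hb1
  have hra : 0 < r ^ (-a) := Real.rpow_pos_of_pos hr _
  calc _ ≤ 2 * π * ((2 * r ^ (-a)) * ((κ⁻¹) ^ (1 / 2 : ℝ) * D * HsNorm s u)) := by
        gcongr
        exact hb1.trans (by gcongr)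
    _ = (4 * π * ((κ⁻¹) ^ (1 / 2 : ℝ) * D)) * HsNorm s u * r ^ (-a) := by ring
    _ ≤ _ := by
        gcongr
        linarith

lemma weight_integrable (α β : ℝ) (hα : -1 < α) (hα0 : α ≤ 0) (hβ : -1 < β) :
    IntegrableOn (fun r : ℝ => (1 - r ^ 2) ^ α * r ^ β) (Ioo 0 1) := by
  have h := Complex.betaIntegral_convergent (u := ((β + 1 : ℝ) : ℂ)) (v := ((α + 1 : ℝ) : ℂ)) (by simp; linarith) (by simp; linarith)
  rw [intervalIntegrable_iff_integrableOn_Ioo_of_le (by norm_num)] at h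
  refine h.norm.mono' ?_ ?_
  · apply Measurable.aestronglyMeasurable
    fun_prop
  refine (ae_restrict_iff' measurableSet_Ioo).2 (Filter.Eventually.of_forall fun r hr => ?_)
  have h0 := hr.1
  have h1 : 0 < 1 - r := by linarith [hr.2]
  have h2 : 0 < 1 - r ^ 2 := by nlinarith
  have e1 : ((r:ℂ) ^ (((β + 1 : ℝ) : ℂ) - 1) * (1 - (r:ℂ)) ^ (((α + 1 : ℝ) : ℂ) - 1)) = ((r ^ β * (1 - r) ^ α : ℝ) : ℂ) := by
    push_cast
    rw [Complex.ofReal_cpow h0.le, Complex.ofReal_cpow h1.le]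
    push_cast
    simp
  rw [e1, Complex.norm_real, Real.norm_of_nonneg (by positivity), Real.norm_of_nonneg (by positivity), mul_comm]
  gcongr ?_ * ?_
  exact Real.rpow_le_rpow_of_nonpos h1 (by nlinarith) hα0

theorem stmt_10 (p : ℝ) (hp : 5 < p) :
    ∃ C : ℝ, 0 < C ∧
      ∀ (u : EuclideanSpace ℝ (Fin 3) → ℂ) (U : ℝ → ℂ),
        Continuous u → Integrable u →
        (∀ x, u x = U ‖x‖) →
        Integrable (fun ξ : EuclideanSpace ℝ (Fin 3) =>
          (1 + ‖ξ‖ ^ 2) ^ (3 / 2 - 2 / (p - 1)) * ‖𝓕 u ξ‖ ^ 2) →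
        ∫ r in (0 : ℝ)..1, (1 - r ^ 2) ^ (2 / (p - 1) - 1) * ‖U r‖ ^ (p + 1) * r ^ 2
          ≤ C * HsNorm (3 / 2 - 2 / (p - 1)) u ^ (p + 1) := by
  have hp1 : 0 < p - 1 := by linarith
  have hp2 : 0 < p + 1 := by linarith
  obtain ⟨a, ha1, ha2⟩ : ∃ a, 2 / (p - 1) < a ∧ a < 3 / (p + 1) := by
    apply exists_between
    rw [div_lt_div_iff₀ hp1 hp2]; linarith
  have hq0 : 0 < 2 / (p - 1) := by positivity
  have hq1 : 2 / (p - 1) < 1 := by rw [div_lt_one hp1]; linarith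
  have ha3 : a ≤ 1 := ha2.le.trans (by rw [div_le_one hp2]; linarith)
  have ha4 : a * (p + 1) < 3 := (lt_div_iff₀ hp2).1 ha2
  obtain ⟨C, hC, h⟩ := pointwise_bound (3 / 2 - 2 / (p - 1)) a (by linarith) ha3 (by linarith)
  set w : ℝ → ℝ := fun r => (1 - r ^ 2) ^ (2 / (p - 1) - 1) * r ^ (2 - a * (p + 1)) with hw
  have hwi : IntegrableOn w (Ioo 0 1) := weight_integrable _ _ (by linarith) (by linarith) (by linarith)
  have hw0 : 0 ≤ ∫ r in Ioo (0:ℝ) 1, w r := by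
    apply setIntegral_nonneg measurableSet_Ioo
    intro r hr
    have h0 := hr.1
    have h2 : 0 < 1 - r ^ 2 := by nlinarith [hr.2]
    simp only [hw]; positivity
  refine ⟨C ^ (p + 1) * (∫ r in Ioo (0:ℝ) 1, w r) + 1, by positivity, ?_⟩
  intro u U huc hui hrad hHs
  set N := HsNorm (3 / 2 - 2 / (p - 1)) u with hN
  have hN0 : 0 ≤ N := by
    rw [hN, HsNorm]
    apply Real.rpow_nonneg
    exact integral_nonneg fun ξ => by positivity
  rw [intervalIntegral.integral_of_le (by norm_num), integral_Ioc_eq_integral_Ioo]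
  calc ∫ r in Ioo (0:ℝ) 1, (1 - r ^ 2) ^ (2 / (p - 1) - 1) * ‖U r‖ ^ (p + 1) * r ^ 2
      ≤ ∫ r in Ioo (0:ℝ) 1, (C ^ (p + 1) * N ^ (p + 1)) * w r := by
        apply integral_mono_of_nonneg
        · refine (ae_restrict_iff' measurableSet_Ioo).2 (Filter.Eventually.of_forall fun r hr => ?_)
          have h0 := hr.1
          have h2 : 0 < 1 - r ^ 2 := by nlinarith [hr.2]
          simp only [Pi.zero_apply]
          positivity
        · exact hwi.const_mul _
        · refine (ae_restrict_iff' measurableSet_Ioo).2 (Filter.Eventually.of_forall fun r hr => ?_)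
          have h0 := hr.1
          have h2 : 0 < 1 - r ^ 2 := by nlinarith [hr.2]
          have hb := h u U huc hui hrad hHs r h0
          have hb2 : ‖U r‖ ^ (p + 1) ≤ C ^ (p + 1) * N ^ (p + 1) * r ^ (-(a * (p + 1))) := by
            calc ‖U r‖ ^ (p + 1) ≤ (C * N * r ^ (-a)) ^ (p + 1) := by gcongr
              _ = _ := by
                rw [Real.mul_rpow (by positivity) (by positivity), Real.mul_rpow hC.le hN0, ← Real.rpow_mul h0.le, neg_mul]
          have e : r ^ (2 - a * (p + 1)) = r ^ (-(a * (p + 1))) * r ^ 2 := by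
            rw [← Real.rpow_natCast r 2, ← Real.rpow_add h0]; congr 1; push_cast; ring
          simp only [hw]
          rw [e]
          calc _ ≤ (1 - r ^ 2) ^ (2 / (p - 1) - 1) * (C ^ (p + 1) * N ^ (p + 1) * r ^ (-(a * (p + 1)))) * r ^ 2 := by gcongr
            _ = _ := by ring
    _ = (C ^ (p + 1) * ∫ r in Ioo (0:ℝ) 1, w r) * N ^ (p + 1) := by
        rw [integral_const_mul]; ring
    _ ≤ _ := by
        gcongr
        linarith
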